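/- arXiv:2206.14559 — 5 statements merged into one kernel-verified Lean document; each statement's English description precedes it below -/
import Mathlib

section
/- Let Ω be a compact metric space and let m be a Borel probability measure on Ω with full support (m(U) > 0 for every nonempty open U). Let a : Ω → ℝ be a continuous function which takes at least one strictly positive value and at least one strictly negative value. Then there exists a continuous function c : Ω → ℝ with c(ω) > 0 for all ω ∈ Ω and ∫_Ω c·a dm = 0. -/
open MeasureTheory

/-- Core construction in the proof of Proposition 4.4: for a full-support Borel
probability measure `m` on a compact metric space and a continuous sign-changing
function `a`, there is a strictly positive continuous weight `c` with `∫ c·a dm = 0`. -/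
theorem stmt_4 {Ω : Type*} [MetricSpace Ω] [CompactSpace Ω]
    [MeasurableSpace Ω] [BorelSpace Ω]
    (m : Measure Ω) [IsProbabilityMeasure m]
    (hfull : ∀ U : Set Ω, IsOpen U → U.Nonempty → 0 < m U)
    (a : Ω → ℝ) (ha : Continuous a)
    (hpos : ∃ ω, 0 < a ω) (hneg : ∃ ω, a ω < 0) :
    ∃ c : Ω → ℝ, Continuous c ∧ (∀ ω, 0 < c ω) ∧ ∫ ω, c ω * a ω ∂m = 0 := by
  have : m.IsOpenPosMeasure := ⟨fun U hU hne => (hfull U hU hne).ne'⟩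
  have integrable {f : Ω → ℝ} (hf : Continuous f) : Integrable f m :=
    hf.integrable_of_hasCompactSupport (HasCompactSupport.of_compactSpace f)
  have sq_pos {f : Ω → ℝ} (hf : Continuous f) {x : Ω} (hx : 0 < f x) :
      0 < ∫ ω, f ω ^ 2 ∂m :=
    (hf.pow 2).integral_pos_of_hasCompactSupport_nonneg_nonzero
      (HasCompactSupport.of_compactSpace _) (fun ω => sq_nonneg (f ω)) (pow_pos hx 2).ne'
  obtain ⟨x, hx⟩ := hpos
  obtain ⟨y, hy⟩ := hneg
  let p : Ω → ℝ := fun ω => max (a ω) 0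
  let n : Ω → ℝ := fun ω => max (-a ω) 0
  have hp : Continuous p := ha.max continuous_const
  have hn : Continuous n := ha.neg.max continuous_const
  have hp0 (ω : Ω) : 0 ≤ p ω := le_max_right _ _
  have hn0 (ω : Ω) : 0 ≤ n ω := le_max_right _ _
  have hA : 0 < ∫ ω, p ω ^ 2 ∂m := sq_pos hp (lt_max_of_lt_left hx)
  have hB : 0 < ∫ ω, n ω ^ 2 ∂m := sq_pos hn (lt_max_of_lt_left (neg_pos.mpr hy))
  have hP : 0 ≤ ∫ ω, p ω ∂m := integral_nonneg hp0
  have hN : 0 ≤ ∫ ω, n ω ∂m := integral_nonneg hn0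
  let t : ℝ := (∫ ω, n ω ∂m) / ∫ ω, p ω ^ 2 ∂m
  let s : ℝ := (∫ ω, p ω ∂m) / ∫ ω, n ω ^ 2 ∂m
  have ht : 0 ≤ t := div_nonneg hN hA.le
  have hs : 0 ≤ s := div_nonneg hP hB.le
  refine ⟨fun ω => 1 + t * p ω + s * n ω, by fun_prop, fun ω => ?_, ?_⟩
  · have := mul_nonneg ht (hp0 ω)
    have := mul_nonneg hs (hn0 ω)
    linarith
  have expand (ω : Ω) : (1 + t * p ω + s * n ω) * a ω =
      (p ω - n ω) + (t * p ω ^ 2 - s * n ω ^ 2) := by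
    rcases le_total 0 (a ω) with h | h
    · have h1 : p ω = a ω := max_eq_left h
      have h2 : n ω = 0 := max_eq_right (neg_nonpos.mpr h)
      rw [h1, h2]
      ring
    · have h1 : p ω = 0 := max_eq_right h
      have h2 : n ω = -a ω := max_eq_left (neg_nonneg.mpr h)
      rw [h1, h2]
      ring
  simp_rw [expand]
  rw [integral_add (integrable (by fun_prop)) (integrable (by fun_prop)),
    integral_sub (integrable hp) (integrable hn),
    integral_sub (integrable (by fun_prop)) (integrable (by fun_prop)),
    integral_const_mul, integral_const_mul, div_mul_cancel₀ _ hA.ne', div_mul_cancel₀ _ hB.ne']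
  ring
end

section
/- Let Ω be a compact metric space, σ : ℝ × Ω → Ω a continuous flow, n ≥ 2, and let m₁, …, m_n be pairwise distinct Borel probability measures on Ω, each σ-invariant (m_i(σ_t⁻¹(A)) = m_i(A) for all t and Borel A) and σ-ergodic (every Borel set A with σ_t⁻¹(A) = A for all t ∈ ℝ has m_i(A) ∈ {0,1}). Let 0 < ε < 1. Then for every i ∈ {1,…,n} there exists a continuous function c_i : Ω → [0,1] with min_{ω∈Ω} c_i(ω) = 0 and max_{ω∈Ω} c_i(ω) = 1, such that c_i(ω)·c_j(ω) = 0 for all ω ∈ Ω whenever i ≠ j, and such that 1 − ε < ∫_Ω c_i dm_i ≤ 1 and 0 ≤ ∫_Ω c_i dm_j < ε for all i ≠ j. -/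
open MeasureTheory

section Flow

variable {X : Type*} [MeasurableSpace X] {φ : ℝ → X → X} {μ ν : Measure X}

/-- A set that is almost everywhere invariant under each time map of a measurable flow agrees
almost everywhere with a strictly invariant set. -/
theorem exists_invariant_ae_eq_of_forall_preimage_ae_eq [SFinite μ]
    (hφ : Measurable fun p : ℝ × X => φ p.1 p.2)
    (hadd : ∀ t s x, φ (t + s) x = φ t (φ s x)) {A : Set X} (hA : MeasurableSet A)
    (hAinv : ∀ t, φ t ⁻¹' A =ᵐ[μ] A) :
    ∃ B, MeasurableSet B ∧ (∀ t, φ t ⁻¹' B = B) ∧ B =ᵐ[μ] A := by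
  have hφ' : Measurable fun p : X × ℝ => φ p.2 p.1 := hφ.comp measurable_swap
  refine ⟨{x | ∀ᵐ t : ℝ, φ t x ∈ A}, ?_, fun t => ?_, ?_⟩
  · exact measurable_measure_prodMk_left (hφ' hA).compl (measurableSet_singleton 0)
  · ext x
    simp only [Set.mem_preimage, Set.mem_ofPred_eq, ← hadd]
    constructor
    · intro h
      filter_upwards [(measurePreserving_add_right volume (-t)).quasiMeasurePreserving.ae h]
        with s hs
      simpa using hs
    · exact (measurePreserving_add_right volume t).quasiMeasurePreserving.ae
  · have hmeas : MeasurableSet {p : X × ℝ | φ p.2 p.1 ∈ A ↔ p.1 ∈ A} :=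
      .iff (hφ' hA) (measurable_fst hA)
    have hae : ∀ᵐ x ∂μ, ∀ᵐ t : ℝ, (φ t x ∈ A ↔ x ∈ A) :=
      (Measure.ae_ae_comm hmeas).2 (.of_forall fun t => (hAinv t).mem_iff)
    refine Filter.eventuallyEq_set.2 (hae.mono fun x hx => ?_)
    simp only [Set.mem_ofPred_eq]
    rw [Filter.eventually_congr hx, Filter.eventually_const]

/-- If one invariant probability measure of a measurable flow is ergodic, the density of another
invariant probability measure with respect to it is almost everywhere constant. -/
theorem exists_rnDeriv_ae_eq_const [IsProbabilityMeasure μ] [IsProbabilityMeasure ν]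
    (hφ : Measurable fun p : ℝ × X => φ p.1 p.2)
    (hadd : ∀ t s x, φ (t + s) x = φ t (φ s x))
    (hμ : ∀ t, MeasurePreserving (φ t) μ μ) (hν : ∀ t, MeasurePreserving (φ t) ν ν)
    (herg : ∀ A, MeasurableSet A → (∀ t, φ t ⁻¹' A = A) → ν A = 0 ∨ ν A = 1) :
    ∃ c, μ.rnDeriv ν =ᵐ[ν] fun _ => c := by
  refine Filter.exists_eventuallyEq_const_of_forall_separating MeasurableSet fun U hU => ?_
  have hA : MeasurableSet (μ.rnDeriv ν ⁻¹' U) := μ.measurable_rnDeriv ν hU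
  obtain ⟨B, hB, hBinv, hBA⟩ := exists_invariant_ae_eq_of_forall_preimage_ae_eq hφ hadd hA
    fun t => ((hμ t).rnDeriv_comp_aeEq (hν t)).preimage U
  rcases herg B hB hBinv with h | h
  · right
    rw [measure_congr hBA] at h
    exact measure_eq_zero_iff_ae_notMem.1 h
  · left
    rw [measure_congr hBA] at h
    exact (mem_ae_iff_prob_eq_one hA).2 h

/-- Two distinct ergodic invariant probability measures of a measurable flow are mutually
singular. -/
theorem mutuallySingular_of_ergodic_flow_of_ne [IsProbabilityMeasure μ] [IsProbabilityMeasure ν]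
    (hφ : Measurable fun p : ℝ × X => φ p.1 p.2)
    (hadd : ∀ t s x, φ (t + s) x = φ t (φ s x))
    (hμ : ∀ t, MeasurePreserving (φ t) μ μ) (hν : ∀ t, MeasurePreserving (φ t) ν ν)
    (hμerg : ∀ A, MeasurableSet A → (∀ t, φ t ⁻¹' A = A) → μ A = 0 ∨ μ A = 1)
    (hνerg : ∀ A, MeasurableSet A → (∀ t, φ t ⁻¹' A = A) → ν A = 0 ∨ ν A = 1)
    (hne : μ ≠ ν) : μ.MutuallySingular ν := by
  obtain ⟨c, hc⟩ := exists_rnDeriv_ae_eq_const hφ hadd hμ hν hνerg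
  obtain ⟨d, hd⟩ := exists_rnDeriv_ae_eq_const hφ hadd hν hμ hμerg
  by_cases hc0 : c = 0
  · subst hc0
    exact (Measure.rnDeriv_eq_zero μ ν).1 hc
  have hνμ : ν ≪ μ := by
    intro s hs
    have h := Measure.le_iff'.1 (Measure.withDensity_rnDeriv_le μ ν) s
    rw [withDensity_congr_ae hc, withDensity_const, hs] at h
    simpa [hc0] using h
  have hνd : ν = d • μ := by
    rw [← withDensity_const, ← withDensity_congr_ae hd,
      Measure.withDensity_rnDeriv_eq _ _ hνμ]
  have hd1 : d = 1 := by simpa using (congrArg (fun m : Measure X => m Set.univ) hνd).symm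
  exact absurd (by rw [hνd, hd1, one_smul]) hne

end Flow

/-- Countably many pairwise mutually singular measures are concentrated on pairwise disjoint
measurable sets. -/
theorem exists_measurable_pairwise_disjoint_of_mutuallySingular {X ι : Type*} [MeasurableSpace X]
    [Countable ι] {m : ι → Measure X} (h : Pairwise fun i j => (m i).MutuallySingular (m j)) :
    ∃ E : ι → Set X, (∀ i, MeasurableSet (E i)) ∧ (∀ i, m i (E i)ᶜ = 0) ∧
      Pairwise fun i j => Disjoint (E i) (E j) := by
  choose S hS hS₁ hS₂ using fun i j (hij : i ≠ j) => h hij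
  refine ⟨fun i => (⋂ (j) (hij : i ≠ j), (S i j hij)ᶜ) ∩ ⋂ (j) (hji : j ≠ i), S j i hji,
    fun i => ?_, fun i => ?_, fun i j hij => ?_⟩
  · exact (MeasurableSet.iInter fun j => .iInter fun hij => (hS i j hij).compl).inter
      (.iInter fun j => .iInter fun hji => hS j i hji)
  · simp [Set.compl_inter, Set.compl_iInter, measure_iUnion_null_iff, hS₁, hS₂]
  · refine Set.disjoint_left.2 fun x hi hj => ?_
    exact Set.mem_iInter₂.1 hi.1 j hij (Set.mem_iInter₂.1 hj.2 i hij)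

/-- Finitely many pairwise disjoint compact sets admit pairwise disjoint thickenings of a common
radius. -/
theorem exists_pos_pairwise_disjoint_thickening {X ι : Type*} [MetricSpace X] [Finite ι]
    {K : ι → Set X} (hK : ∀ i, IsCompact (K i))
    (hdisj : Pairwise fun i j => Disjoint (K i) (K j)) :
    ∃ δ : ℝ, 0 < δ ∧
      Pairwise fun i j => Disjoint (Metric.thickening δ (K i)) (Metric.thickening δ (K j)) := by
  have hev : ∀ᶠ δ : ℝ in nhdsWithin 0 (Set.Ioi 0), ∀ i j, i ≠ j →
      Disjoint (Metric.thickening δ (K i)) (Metric.thickening δ (K j)) := by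
    simp only [Filter.eventually_all]
    intro i j hij
    obtain ⟨δ, hδ, h⟩ := (hdisj hij).exists_thickenings (hK i) (hK j).isClosed
    filter_upwards [Ioo_mem_nhdsGT hδ] with r hr
    exact h.mono (Metric.thickening_mono hr.2.le _) (Metric.thickening_mono hr.2.le _)
  obtain ⟨δ, h, hδ⟩ := (hev.and self_mem_nhdsWithin).exists
  exact ⟨δ, hδ, fun i j hij => h i j hij⟩

/-- Lemma 7.4: given `n ≥ 2` pairwise distinct ergodic invariant Borel probability
measures of a continuous flow on a compact metric space and `0 < ε < 1`, there are
continuous functions `cᵢ : Ω → [0,1]`, with minimum `0` and maximum `1`, pairwise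
disjointly supported, with `1 - ε < ∫ cᵢ dmᵢ ≤ 1` and `0 ≤ ∫ cᵢ dmⱼ < ε` for `j ≠ i`. -/
theorem stmt_5 {Ω : Type*} [MetricSpace Ω] [CompactSpace Ω]
    [MeasurableSpace Ω] [BorelSpace Ω]
    (σ : ℝ → Ω → Ω)
    (hσcont : Continuous fun p : ℝ × Ω => σ p.1 p.2)
    (hσ0 : ∀ ω, σ 0 ω = ω)
    (hσadd : ∀ t s ω, σ (t + s) ω = σ t (σ s ω))
    (n : ℕ) (hn : 2 ≤ n)
    (m : Fin n → Measure Ω) [∀ i, IsProbabilityMeasure (m i)]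
    (hinv : ∀ i (t : ℝ) (A : Set Ω), MeasurableSet A → m i (σ t ⁻¹' A) = m i A)
    (herg : ∀ i (A : Set Ω), MeasurableSet A → (∀ t, σ t ⁻¹' A = A) →
      m i A = 0 ∨ m i A = 1)
    (hdist : ∀ i j, i ≠ j → m i ≠ m j)
    (ε : ℝ) (hε0 : 0 < ε) (hε1 : ε < 1) :
    ∃ c : Fin n → Ω → ℝ,
      ∀ i, Continuous (c i) ∧ (∀ ω, c i ω ∈ Set.Icc (0:ℝ) 1) ∧
        (∃ ω, c i ω = 0) ∧ (∃ ω, c i ω = 1) ∧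
        (∀ j, j ≠ i → ∀ ω, c i ω * c j ω = 0) ∧
        (1 - ε < ∫ ω, c i ω ∂(m i) ∧ ∫ ω, c i ω ∂(m i) ≤ 1) ∧
        (∀ j, j ≠ i → 0 ≤ ∫ ω, c i ω ∂(m j) ∧ ∫ ω, c i ω ∂(m j) < ε) := by
  have hmeas : Measurable fun p : ℝ × Ω => σ p.1 p.2 := hσcont.measurable
  have hmp : ∀ i t, MeasurePreserving (σ t) (m i) (m i) := fun i t =>
    have ht : Measurable (σ t) := hmeas.comp measurable_prodMk_left
    ⟨ht, Measure.ext fun A hA => by rw [Measure.map_apply ht hA, hinv i t A hA]⟩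
  obtain ⟨E, hE, hEnull, hEdisj⟩ :=
    exists_measurable_pairwise_disjoint_of_mutuallySingular (m := m) fun i j hij =>
      mutuallySingular_of_ergodic_flow_of_ne hmeas hσadd (hmp i) (hmp j) (herg i) (herg j)
        (hdist i j hij)
  have hcompact : ∀ i, ∃ K ⊆ E i, IsCompact K ∧ ENNReal.ofReal (1 - ε) < m i K := by
    intro i
    refine (hE i).exists_lt_isCompact ?_
    rw [(prob_compl_eq_zero_iff (hE i)).1 (hEnull i)]
    simpa using hε0
  choose K hKE hK hKm using hcompact
  obtain ⟨δ, hδ, hthick⟩ := exists_pos_pairwise_disjoint_thickening hK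
    fun i j hij => (hEdisj hij).mono (hKE i) (hKE j)
  let c : Fin n → Ω → ℝ := fun i ω => thickenedIndicator hδ (K i) ω
  have hcont : ∀ i, Continuous (c i) := fun i =>
    NNReal.continuous_coe.comp (thickenedIndicator hδ (K i)).continuous
  have hc0 : ∀ i ω, 0 ≤ c i ω := fun i ω => NNReal.coe_nonneg _
  have hc1 : ∀ i ω, c i ω ≤ 1 := fun i ω => by
    exact_mod_cast thickenedIndicator_le_one hδ (K i) ω
  have hcK : ∀ i, ∀ ω ∈ K i, c i ω = 1 := fun i ω hω => by
    simp only [c, thickenedIndicator_one hδ (K i) hω, NNReal.coe_one]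
  have hzero : ∀ i j, j ≠ i → ∀ ω, c i ω = 0 ∨ c j ω = 0 := by
    intro i j hji ω
    by_cases hω : ω ∈ Metric.thickening δ (K i)
    · right
      simp only [c, thickenedIndicator_zero hδ (K j) (Set.disjoint_right.1 (hthick hji) hω),
        NNReal.coe_zero]
    · left
      simp only [c, thickenedIndicator_zero hδ (K i) hω, NNReal.coe_zero]
  have hint : ∀ i j, Integrable (c i) (m j) := fun i j =>
    (hcont i).integrable_of_hasCompactSupport (.of_compactSpace _)
  have hlower : ∀ i, 1 - ε < ∫ ω, c i ω ∂(m i) := by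
    intro i
    calc
      1 - ε < (m i).real (K i) :=
        (ENNReal.ofReal_lt_iff_lt_toReal (by linarith) (by simp)).1 (hKm i)
      _ = ∫ ω, (K i).indicator 1 ω ∂(m i) := (integral_indicator_one (hK i).measurableSet).symm
      _ ≤ ∫ ω, c i ω ∂(m i) := by
        refine integral_mono ((integrable_const 1).indicator (hK i).measurableSet) (hint i i) ?_
        exact Set.indicator_le' (fun ω hω => (hcK i ω hω).ge) fun ω _ => hc0 i ω
  have hone : ∀ i, ∃ ω, c i ω = 1 := fun i =>
    (nonempty_of_measure_ne_zero (zero_le.trans_lt (hKm i)).ne').imp (hcK i)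
  refine ⟨c, fun i => ⟨hcont i, fun ω => ⟨hc0 i ω, hc1 i ω⟩, ?_, hone i, ?_, ⟨hlower i, ?_⟩, ?_⟩⟩
  · have : Nontrivial (Fin n) := Fin.nontrivial_iff_two_le.2 hn
    obtain ⟨j, hji⟩ := exists_ne i
    obtain ⟨ω, hω⟩ := hone j
    exact ⟨ω, (hzero i j hji ω).resolve_right (by simp [hω])⟩
  · exact fun j hji ω => mul_eq_zero.2 (hzero i j hji ω)
  · simpa using integral_mono (hint i i) (integrable_const 1) (hc1 i)
  · refine fun j hji => ⟨integral_nonneg (hc0 i), ?_⟩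
    have hsum : ∫ ω, c i ω + c j ω ∂(m j) ≤ ∫ _, (1 : ℝ) ∂(m j) := by
      refine integral_mono ((hint i j).add (hint j j)) (integrable_const 1) fun ω => ?_
      rcases hzero i j hji ω with h | h <;> simp [h, hc1]
    rw [integral_add (hint i j) (hint j j)] at hsum
    simp only [integral_const, probReal_univ, one_smul] at hsum
    linarith [hlower j]
end

section
/- Let n ≥ 2, r ≥ 1, and set ε₁ = (n + 2r(n−1) − 2√(r(n−1)(r(n−1)+n)))/n². Let 0 < ε < ε₁, let α₁ ≤ α₂ ≤ ⋯ ≤ α_n be real numbers with α₁ < 0 and α_n > 0, and let λ₋, λ₊ be real numbers satisfying α₁ ≤ −λ₊ < α₁(1−ε) + (n−1)α_n ε and α_n(1−ε) + (n−1)α₁ ε < −λ₋ ≤ α_n. Then λ₊ − λ₋ > (1 − nε)(α_n − α₁) > 0, and (λ₊ − λ₋)² + 4r(λ₊ + α₁)(λ₊ + α_n) > 0. -/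
/-- Below the smaller root of `(1 - N * x) ^ 2 = 4 * s * x`, one has `N * x < 1` and
`4 * s * x < (1 - N * x) ^ 2`. -/
theorem mul_lt_one_and_lt_sq_of_lt_smaller_root {N s x : ℝ} (hN : 0 < N) (hs : 0 < s)
    (hx : x < (N + 2 * s - 2 * Real.sqrt (s * (s + N))) / N ^ 2) :
    N * x < 1 ∧ 4 * s * x < (1 - N * x) ^ 2 := by
  rw [lt_div_iff₀ (by positivity)] at hx
  have hS : Real.sqrt (s * (s + N)) ^ 2 = s * (s + N) := Real.sq_sqrt (by positivity)
  have hsS : s < Real.sqrt (s * (s + N)) := Real.lt_sqrt_of_sq_lt (by nlinarith [mul_pos hs hN])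
  constructor
  · have h : N * (N * x) < N * 1 := by nlinarith
    exact lt_of_mul_lt_mul_left h hN.le
  · have h : (2 * Real.sqrt (s * (s + N))) ^ 2 < (N + 2 * s - x * N ^ 2) ^ 2 :=
      pow_lt_pow_left₀ (by linarith) (by positivity) two_ne_zero
    have h' : N ^ 2 * (4 * s * x) < N ^ 2 * (1 - N * x) ^ 2 := by
      rw [mul_pow, hS] at h
      linarith
    exact lt_of_mul_lt_mul_left h' (by positivity)


/-- Algebraic core of Proposition 7.5: the band-spectrum condition
`(λ₊-λ₋)² + 4r(λ₊+α₁)(λ₊+αₙ) > 0` from the estimates on `-λ₊` and `-λ₋`. -/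
theorem stmt_7 (n : ℕ) (hn : 2 ≤ n) (r : ℝ) (hr : 1 ≤ r)
    (ε₁ : ℝ)
    (hε₁ : ε₁ = ((n : ℝ) + 2 * r * ((n : ℝ) - 1)
      - 2 * Real.sqrt (r * ((n : ℝ) - 1) * (r * ((n : ℝ) - 1) + (n : ℝ)))) / (n : ℝ) ^ 2)
    (ε : ℝ) (hε0 : 0 < ε) (hεlt : ε < ε₁)
    (α : Fin n → ℝ) (hmono : Monotone α)
    (hα1 : α ⟨0, by omega⟩ < 0) (hαn : 0 < α ⟨n - 1, by omega⟩)
    (lamM lamP : ℝ)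
    (h1 : α ⟨0, by omega⟩ ≤ -lamP)
    (h2 : -lamP < α ⟨0, by omega⟩ * (1 - ε) + ((n : ℝ) - 1) * α ⟨n - 1, by omega⟩ * ε)
    (h3 : α ⟨n - 1, by omega⟩ * (1 - ε) + ((n : ℝ) - 1) * α ⟨0, by omega⟩ * ε < -lamM)
    (h4 : -lamM ≤ α ⟨n - 1, by omega⟩) :
    lamP - lamM > (1 - (n : ℝ) * ε) * (α ⟨n - 1, by omega⟩ - α ⟨0, by omega⟩) ∧
    (1 - (n : ℝ) * ε) * (α ⟨n - 1, by omega⟩ - α ⟨0, by omega⟩) > 0 ∧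
    (lamP - lamM) ^ 2
      + 4 * r * (lamP + α ⟨0, by omega⟩) * (lamP + α ⟨n - 1, by omega⟩) > 0 := by
  generalize α ⟨0, _⟩ = a at *
  generalize α ⟨n - 1, _⟩ = b at *
  have hN : (2 : ℝ) ≤ n := by exact_mod_cast hn
  generalize (n : ℝ) = N at *
  have hs : 0 < r * (N - 1) := mul_pos (by linarith) (by linarith)
  obtain ⟨hNε, hq⟩ := mul_lt_one_and_lt_sq_of_lt_smaller_root (N := N) (x := ε)
    (by linarith) hs (by rw [hε₁] at hεlt; convert hεlt using 2; ring)
  have hD : 0 < b - a := by linarith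
  have hpos : 0 < (1 - N * ε) * (b - a) := mul_pos (by linarith) hD
  have hgap : (1 - N * ε) * (b - a) < lamP - lamM := by linarith
  refine ⟨hgap, hpos, ?_⟩
  have hsq : ((1 - N * ε) * (b - a)) ^ 2 < (lamP - lamM) ^ 2 :=
    pow_lt_pow_left₀ hgap hpos.le two_ne_zero
  have hu : -lamP - a ≤ (N - 1) * ε * (b - a) := by
    nlinarith [mul_nonneg (mul_nonneg hε0.le (sub_nonneg.2 hN)) (neg_pos.2 hα1).le]
  have hprod : (-lamP - a) * (b + lamP) ≤ (N - 1) * ε * (b - a) * (b - a) := by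
    nlinarith [mul_le_mul_of_nonneg_right hu hD.le, sq_nonneg (-lamP - a)]
  have hr' := mul_le_mul_of_nonneg_left hprod (show 0 ≤ 4 * r by linarith)
  have hq' := mul_lt_mul_of_pos_right hq (pow_pos hD 2)
  linarith
end

section
/- Let Ω be a compact topological space, let h : Ω × ℝ → ℝ be continuous, let r < r₁ be real numbers, and let a₃ : Ω → ℝ be continuous with a₃(ω) ≥ r₁ for all ω ∈ Ω. Assume that (−r + h(ω,x))x³ is coercive uniformly on Ω, i.e. for every M > 0 there exists ρ > 0 such that (−r + h(ω,x))x² ≤ −M for all ω ∈ Ω and all x with |x| ≥ ρ. Then (−a₃(ω) + h(ω,x))x³ is 2-coercive uniformly on Ω: for every M > 0 there exists ρ > 0 such that, for all ω ∈ Ω, (−a₃(ω) + h(ω,x))x ≤ −M whenever x ≥ ρ, and (−a₃(ω) + h(ω,x))x ≥ M whenever x ≤ −ρ. -/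
/-- Coercivity transfer of Proposition 6.2: if `(-r + h(ω,x))x³` is (Co) with
`r < r₁ ≤ a₃`, then `(-a₃(ω) + h(ω,x))x³` is (Co)₂, uniformly on `Ω`. -/
theorem stmt_10 {Ω : Type*} [TopologicalSpace Ω] [CompactSpace Ω]
    (h : Ω → ℝ → ℝ) (hcont : Continuous fun p : Ω × ℝ => h p.1 p.2)
    (r r₁ : ℝ) (hr : r < r₁)
    (a₃ : Ω → ℝ) (ha₃cont : Continuous a₃) (ha₃ : ∀ ω, r₁ ≤ a₃ ω)
    (hco : ∀ M : ℝ, 0 < M → ∃ ρ : ℝ, 0 < ρ ∧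
      ∀ (ω : Ω) (x : ℝ), ρ ≤ |x| → (-r + h ω x) * x ^ 2 ≤ -M) :
    ∀ M : ℝ, 0 < M → ∃ ρ : ℝ, 0 < ρ ∧
      ∀ ω : Ω, (∀ x : ℝ, ρ ≤ x → (-(a₃ ω) + h ω x) * x ≤ -M) ∧
        (∀ x : ℝ, x ≤ -ρ → M ≤ (-(a₃ ω) + h ω x) * x) := by
  intro M hM
  obtain ⟨ρ, hρ, hbound⟩ := hco 1 one_pos
  have hd : 0 < r₁ - r := sub_pos.mpr hr
  have hcoeff : ∀ (ω : Ω) (x : ℝ), ρ ≤ |x| → -(a₃ ω) + h ω x ≤ -(r₁ - r) := by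
    intro ω x hx
    have hx2 : 0 < x ^ 2 := sq_pos_of_ne_zero (abs_pos.mp (hρ.trans_le hx))
    have hneg : -r + h ω x < 0 := by
      by_contra! hnonneg
      linarith [hbound ω x hx, mul_nonneg hnonneg hx2.le]
    linarith [ha₃ ω]
  refine ⟨max ρ (M / (r₁ - r)), lt_max_of_lt_left hρ, fun ω => ⟨fun x hx => ?_, fun x hx => ?_⟩⟩
  · obtain ⟨hx₁, hx₂⟩ := max_le_iff.mp hx
    have hM' : M ≤ x * (r₁ - r) := (div_le_iff₀ hd).mp hx₂
    have hmul := mul_le_mul_of_nonneg_right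
      (hcoeff ω x (hx₁.trans (le_abs_self x))) (hρ.le.trans hx₁)
    linarith
  · obtain ⟨hx₁, hx₂⟩ := max_le_iff.mp (le_neg_of_le_neg hx)
    have hM' : M ≤ -x * (r₁ - r) := (div_le_iff₀ hd).mp hx₂
    have hmul := mul_le_mul_of_nonneg_right
      (hcoeff ω x (hx₁.trans (neg_le_abs x))) (hρ.le.trans hx₁)
    linarith
end

section
/- Let A, B : ℝ → ℝ be continuous, and let r, K, α, t_α be positive real numbers such that 0 < B(t) ≤ r and |A(t)| ≤ K for all t ≥ 0, α² < 2r, and ∫_t^{t+t_α} A(s) ds ≥ α·t_α for every t ≥ 0. Let w : ℝ → ℝ satisfy w(0) = α, w(t) > 0 for all t ≥ 0, and for every t ≥ 0 the derivative w'(t) exists and equals −A(t) + B(t)/w(t). Then w(t) ≤ 2r/α + (r/α + K)·t_α for all t ≥ 0. -/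
open MeasureTheory intervalIntegral

/-- If `w' ≤ -A + c` on the interior of `[a, b]`, then `w b - w a ≤ c (b - a) - ∫ A`. -/
theorem le_sub_integral_of_hasDerivAt_le {A w w' : ℝ → ℝ} (hA : Continuous A) {a b c : ℝ}
    (hab : a ≤ b) (hw : ∀ t ∈ Set.Icc a b, HasDerivAt w (w' t) t)
    (hle : ∀ t ∈ Set.Ioo a b, w' t ≤ -A t + c) :
    w b ≤ w a + c * (b - a) - ∫ s in a..b, A s := by
  have hd : ∀ t ∈ Set.Icc a b, HasDerivAt
      (fun t => w t + (∫ s in a..t, A s) - c * (t - a)) (w' t + A t - c * 1) t := fun t ht =>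
    ((hw t ht).add (hA.integral_hasStrictDerivAt a t).hasDerivAt).sub
      (((hasDerivAt_id t).sub_const a).const_mul c)
  have hanti : AntitoneOn (fun t => w t + (∫ s in a..t, A s) - c * (t - a)) (Set.Icc a b) := by
    refine antitoneOn_of_deriv_nonpos (convex_Icc a b)
      (fun t ht => (hd t ht).continuousAt.continuousWithinAt) ?_ ?_ <;>
    rw [interior_Icc] <;> intro t ht
    · exact (hd t (Set.Ioo_subset_Icc_self ht)).differentiableAt.differentiableWithinAt
    · rw [(hd t (Set.Ioo_subset_Icc_self ht)).deriv]
      linarith [hle t ht]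
  have h := hanti (Set.left_mem_Icc.2 hab) (Set.right_mem_Icc.2 hab) hab
  simp only [integral_same, sub_self, mul_zero] at h
  linarith

/-- Riccati-type boundedness estimate from the proof of Proposition 5.2:
a positive solution of `w' = -A(t) + B(t)/w` with `w(0) = α` stays below
`2r/α + (r/α + K)t_α` on `[0,∞)`. -/
theorem stmt_12 (A B : ℝ → ℝ) (hA : Continuous A) (hB : Continuous B)
    (r K α tα : ℝ) (hr : 0 < r) (hK : 0 < K) (hα : 0 < α) (htα : 0 < tα)
    (hBpos : ∀ t : ℝ, 0 ≤ t → 0 < B t ∧ B t ≤ r)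
    (hAbd : ∀ t : ℝ, 0 ≤ t → |A t| ≤ K)
    (hα2 : α ^ 2 < 2 * r)
    (hint : ∀ t : ℝ, 0 ≤ t → α * tα ≤ ∫ s in t..(t + tα), A s)
    (w : ℝ → ℝ) (hw0 : w 0 = α) (hwpos : ∀ t : ℝ, 0 ≤ t → 0 < w t)
    (hode : ∀ t : ℝ, 0 ≤ t → HasDerivAt w (-A t + B t / w t) t) :
    ∀ t : ℝ, 0 ≤ t → w t ≤ 2 * r / α + (r / α + K) * tα := by
  intro t ht
  have hM : 0 < 2 * r / α := by positivity
  have hαM : α ≤ 2 * r / α := by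
    rw [le_div_iff₀ hα]
    nlinarith
  have hwc : ContinuousOn w (Set.Icc 0 t) := fun s hs =>
    (hode s hs.1).continuousAt.continuousWithinAt
  obtain ⟨a, ⟨⟨ha0, hat⟩, haM⟩, hmax⟩ :
      ∃ a, IsGreatest (Set.Icc 0 t ∩ w ⁻¹' Set.Iic (2 * r / α)) a :=
    (isCompact_Icc.of_isClosed_subset (hwc.preimage_isClosed_of_isClosed isClosed_Icc isClosed_Iic)
      Set.inter_subset_left).exists_isGreatest ⟨0, ⟨le_rfl, ht⟩, by simpa [hw0] using hαM⟩
  have hgt : ∀ s, a < s → s ≤ t → 2 * r / α < w s := by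
    intro s has hst
    by_contra! h
    exact absurd (hmax ⟨⟨ha0.trans has.le, hst⟩, h⟩) (not_le.2 has)
  have hbound : ∀ b, a ≤ b → b ≤ t →
      w b ≤ 2 * r / α + α / 2 * (b - a) - ∫ s in a..b, A s := by
    intro b hab hbt
    have h := le_sub_integral_of_hasDerivAt_le (c := α / 2) hA hab
      (fun s hs => hode s (ha0.trans hs.1)) (fun s hs => by
        have hs0 : 0 ≤ s := ha0.trans hs.1.le
        have hws := hgt s hs.1 (hs.2.le.trans hbt)
        rw [div_lt_iff₀ hα] at hws
        have : B s / w s ≤ α / 2 := by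
          rw [div_le_iff₀ (hwpos s hs0)]
          linarith [(hBpos s hs0).2]
        linarith)
    linarith [show w a ≤ 2 * r / α from haM]
  have hshort : t - a ≤ tα := by
    by_contra! h
    have h₁ := hbound (a + tα) (by linarith) (by linarith)
    have h₂ := hgt (a + tα) (by linarith) (by linarith)
    nlinarith [hint a ha0, mul_pos hα htα]
  have hA_int : -(K * (t - a)) ≤ ∫ s in a..t, A s := by
    have h := norm_integral_le_of_norm_le_const (a := a) (b := t) (f := A) (C := K) (fun s hs => by
      rw [Set.uIoc_of_le hat] at hs
      exact hAbd s (ha0.trans hs.1.le))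
    rw [abs_of_nonneg (sub_nonneg.2 hat), Real.norm_eq_abs] at h
    exact (abs_le.1 h).1
  have hslope : α / 2 ≤ r / α := by linarith [mul_div_assoc 2 r α]
  calc w t ≤ 2 * r / α + (α / 2 + K) * (t - a) := by linarith [hbound t hat le_rfl]
    _ ≤ 2 * r / α + (r / α + K) * tα := by
      gcongr
end
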